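/- For every λ > 0 and every z ∈ ℂ with Re z > 0, the Laplace transform of ψ_λ is ∫₀^∞ ψ_λ(x)·e^{−z·x} dx = (√2/2)·λ·e^{B(z/λ)}/(λ² + z²). -/

import Mathlib

open Real MeasureTheory Set Complex

/-- `η t = (1/4)·log(1+t²) − (1/π)·∫₀^t log|s|/(1+s²) ds`. -/
noncomputable def etaF (t : ℝ) : ℝ :=
  Real.log (1 + t ^ 2) / 4 - (1 / Real.pi) * ∫ s in (0 : ℝ)..t, Real.log |s| / (1 + s ^ 2)

/-- The remainder term `r`. -/
noncomputable def rfun (x : ℝ) : ℝ :=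
  (Real.sqrt 2 / (2 * Real.pi)) *
    ∫ t in Ioi (0 : ℝ), (t / (1 + t ^ 2)) * Real.exp (-etaF t) * Real.exp (-t * x)

/-- The generalized eigenfunction `ψ_λ`. -/
noncomputable def psi (lam x : ℝ) : ℝ :=
  if 0 < x then Real.sin (lam * x + Real.pi / 8) - rfun (lam * x) else 0

/-- `B z = (1/π)·∫_{−∞}^0 log(z−s)/(1+s²) ds`, principal branch of `log`. -/
noncomputable def Bfun (z : ℂ) : ℂ :=
  (1 / (Real.pi : ℂ)) * ∫ s in Iio (0 : ℝ), Complex.log (z - (s : ℂ)) / (1 + (s : ℂ) ^ 2)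

section

open Filter Topology

/-- The quotient `N / D`, extended through the simple zeros of `D` by l'Hôpital's rule. -/
noncomputable def quotExt (N D : ℂ → ℂ) (z : ℂ) : ℂ :=
  if D z = 0 then deriv N z / deriv D z else N z / D z

lemma quotExt_of_ne {N D : ℂ → ℂ} {z : ℂ} (h : D z ≠ 0) : quotExt N D z = N z / D z := if_neg h

lemma quotExt_of_eq {N D : ℂ → ℂ} {z : ℂ} (h : D z = 0) :
    quotExt N D z = deriv N z / deriv D z := if_pos h

lemma differentiableOn_quotExt {U : Set ℂ} (hU : IsOpen U) {N D : ℂ → ℂ}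
    (hN : DifferentiableOn ℂ N U) (hD : DifferentiableOn ℂ D U)
    (h : ∀ z ∈ U, D z = 0 → N z = 0 ∧ deriv D z ≠ 0) :
    DifferentiableOn ℂ (quotExt N D) U := by
  intro a ha
  apply DifferentiableAt.differentiableWithinAt
  have hUa := hU.mem_nhds ha
  by_cases hDa : D a = 0
  · obtain ⟨hNa, hD'⟩ := h a ha hDa
    have hN1 : DifferentiableAt ℂ (dslope N a) a :=
      ((differentiableOn_dslope hUa).2 hN).differentiableAt hUa
    have hD1 : DifferentiableAt ℂ (dslope D a) a :=
      ((differentiableOn_dslope hUa).2 hD).differentiableAt hUa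
    have hne : dslope D a a ≠ 0 := by rwa [dslope_same]
    refine (hN1.div hD1 hne).congr_of_eventuallyEq ?_
    filter_upwards [hD1.continuousAt.eventually_ne hne] with z hz
    simp only [Pi.div_apply]
    rcases eq_or_ne z a with rfl | hza
    · rw [quotExt_of_eq hDa, dslope_same, dslope_same]
    · have hz' : z - a ≠ 0 := sub_ne_zero.2 hza
      have e1 : dslope N a z = N z / (z - a) := by
        rw [dslope_of_ne _ hza, slope_def_field, hNa, sub_zero]
      have e2 : dslope D a z = D z / (z - a) := by
        rw [dslope_of_ne _ hza, slope_def_field, hDa, sub_zero]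
      have hDz : D z ≠ 0 := by
        intro h0; apply hz; rw [e2, h0, zero_div]
      rw [quotExt_of_ne hDz, e1, e2, div_div_div_cancel_right₀ hz']
  · have hNa := hN.differentiableAt hUa
    have hDa' := hD.differentiableAt hUa
    refine (hNa.div hDa' hDa).congr_of_eventuallyEq ?_
    filter_upwards [hDa'.continuousAt.eventually_ne hDa] with z hz
    exact quotExt_of_ne hz

lemma exists_primitive_of_starConvex {U : Set ℂ} (hU : IsOpen U) (hstar : StarConvex ℝ 0 U)
    {f : ℂ → ℂ} (hf : DifferentiableOn ℂ f U) : ∃ F : ℂ → ℂ, ∀ z ∈ U, HasDerivAt F (f z) z := by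
  have hmem : ∀ z ∈ U, ∀ t ∈ Icc (0 : ℝ) 1, (t : ℂ) * z ∈ U := by
    intro z hz t ht
    simpa using hstar.smul_mem hz ht.1 ht.2
  have hf' : ContinuousOn (deriv f) U := (hf.deriv hU).continuousOn
  refine ⟨fun z => ∫ t in (0 : ℝ)..1, f (t * z) * z, fun z₀ hz₀ => ?_⟩
  obtain ⟨ε, hε, hball⟩ := Metric.nhds_basis_closedBall.mem_iff.1 (hU.mem_nhds hz₀)
  set F' : ℂ → ℝ → ℂ := fun z t => f (t * z) + t * deriv f (t * z) * z with hF'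
  have hmaps : MapsTo (fun p : ℂ × ℝ => (p.2 : ℂ) * p.1) (Metric.closedBall z₀ ε ×ˢ Icc (0 : ℝ) 1)
      U := fun p hp => hmem _ (hball hp.1) _ hp.2
  have hcm : Continuous (fun p : ℂ × ℝ => (p.2 : ℂ) * p.1) := by fun_prop
  have hc1 : ContinuousOn (fun p : ℂ × ℝ => F' p.1 p.2)
      (Metric.closedBall z₀ ε ×ˢ Icc (0 : ℝ) 1) := by
    have c1 := hf.continuousOn.comp hcm.continuousOn hmaps
    have c2 := hf'.comp hcm.continuousOn hmaps
    have c3 : Continuous (fun p : ℂ × ℝ => (p.2 : ℂ)) := by fun_prop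
    exact c1.add ((c3.continuousOn.mul c2).mul continuous_fst.continuousOn)
  obtain ⟨C, hC⟩ := ((isCompact_closedBall z₀ ε).prod isCompact_Icc).exists_bound_of_continuousOn hc1
  have hu : uIoc (0 : ℝ) 1 = Ioc 0 1 := uIoc_of_le zero_le_one
  have hcz : ∀ z ∈ Metric.closedBall z₀ ε, ContinuousOn (fun t : ℝ => f (t * z) * z) (Icc 0 1) := by
    intro z hz
    have : ContinuousOn (fun t : ℝ => f (t * z)) (Icc 0 1) :=
      hf.continuousOn.comp (by fun_prop) fun t ht => hmem z (hball hz) t ht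
    exact this.mul continuousOn_const
  have hz₀' : z₀ ∈ Metric.closedBall z₀ ε := Metric.mem_closedBall_self hε.le
  have hF'c : ContinuousOn (F' z₀) (Icc 0 1) :=
    hc1.comp (f := fun t : ℝ => (z₀, t)) (by fun_prop) fun t ht => ⟨hz₀', ht⟩
  have hderz : ∀ z ∈ U, ∀ t ∈ Icc (0 : ℝ) 1,
      HasDerivAt f (deriv f (t * z)) (t * z) := fun z hz t ht =>
    (hf.differentiableAt (hU.mem_nhds (hmem z hz t ht))).hasDerivAt
  have key := intervalIntegral.hasDerivAt_integral_of_dominated_loc_of_deriv_le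
    (μ := volume) (a := 0) (b := 1) (F := fun z t => f ((t : ℝ) * z) * z) (F' := F') (x₀ := z₀)
    (bound := fun _ => C) (Metric.closedBall_mem_nhds z₀ hε)
    (by
      filter_upwards [Metric.closedBall_mem_nhds z₀ hε] with z hz
      rw [hu]
      exact ((hcz z hz).mono Ioc_subset_Icc_self).aestronglyMeasurable measurableSet_Ioc)
    ((hcz z₀ hz₀').intervalIntegrable_of_Icc zero_le_one)
    (by
      rw [hu]
      exact (hF'c.mono Ioc_subset_Icc_self).aestronglyMeasurable measurableSet_Ioc)
    (by
      refine ae_of_all _ fun t ht z hz => ?_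
      rw [hu] at ht
      exact hC (z, t) ⟨hz, Ioc_subset_Icc_self ht⟩)
    (by simp)
    (by
      refine ae_of_all _ fun t ht z hz => ?_
      rw [hu] at ht
      have h1 := (hderz z (hball hz) t (Ioc_subset_Icc_self ht))
      have h2 : HasDerivAt (fun z : ℂ => (t : ℂ) * z) t z := by
        simpa using (hasDerivAt_id z).const_mul (t : ℂ)
      have h3 := (h1.comp z h2).mul (hasDerivAt_id z)
      refine h3.congr_deriv ?_
      simp only [hF', id, Function.comp]
      ring)
  have hval : ∫ t in (0 : ℝ)..1, F' z₀ t = f z₀ := by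
    rw [intervalIntegral.integral_eq_sub_of_hasDerivAt (f := fun t : ℝ => (t : ℂ) * f (t * z₀))]
    · simp
    · intro t ht
      rw [uIcc_of_le zero_le_one] at ht
      have h1 := hderz z₀ hz₀ t ht
      have h2 : HasDerivAt (fun t : ℝ => (t : ℂ) * z₀) z₀ t := by
        simpa using (Complex.ofRealCLM.hasDerivAt (x := t)).mul_const z₀
      have h3 := (Complex.ofRealCLM.hasDerivAt (x := t)).mul (h1.comp t h2)
      refine h3.congr_deriv ?_
      simp [hF']
      ring
    · exact hF'c.intervalIntegrable_of_Icc zero_le_one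
  rw [← hval]
  exact key.2

lemma eq_of_hasDerivAt_of_tendsto_atBot {f g : ℝ → ℂ} {f' : ℝ → ℂ} {l : ℂ}
    (hf : ∀ x, HasDerivAt f (f' x) x) (hg : ∀ x, HasDerivAt g (f' x) x)
    (hfl : Tendsto f atBot (𝓝 l)) (hgl : Tendsto g atBot (𝓝 l)) (x : ℝ) : f x = g x := by
  have hd : ∀ x, HasDerivAt (fun x => f x - g x) 0 x := fun x => by
    have h := (hf x).sub (hg x)
    rw [sub_self] at h
    exact h
  have hc : ∀ y, f y - g y = f x - g x := fun y =>
    is_const_of_deriv_eq_zero (fun z => (hd z).differentiableAt) (fun z => (hd z).deriv) y x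
  have h0 : Tendsto (fun x => f x - g x) atBot (𝓝 0) := by simpa using hfl.sub hgl
  have h1 : Tendsto (fun y : ℝ => f y - g y) atBot (𝓝 (f x - g x)) := by
    simp only [hc]; exact tendsto_const_nhds
  exact sub_eq_zero.1 (tendsto_nhds_unique h1 h0)

/-- The horizontal strip `|Im ζ| < 3π/2`. -/
def strip : Set ℂ := {ζ | |ζ.im| < 3 * Real.pi / 2}

lemma isOpen_strip : IsOpen strip :=
  isOpen_lt (continuous_abs.comp Complex.continuous_im) continuous_const

lemma convex_strip : Convex ℝ strip := by
  have h : strip = Complex.imLm ⁻¹' Ioo (-(3 * Real.pi / 2)) (3 * Real.pi / 2) := by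
    ext z; simp [strip, abs_lt]
  rw [h]
  exact (convex_Ioo _ _).linear_preimage _

lemma zero_mem_strip : (0 : ℂ) ∈ strip := by
  simp only [strip, mem_ofPred_eq, Complex.zero_im, abs_zero]; positivity

lemma neg_mem_strip {ζ : ℂ} (h : ζ ∈ strip) : -ζ ∈ strip := by
  simpa [strip] using h

lemma mem_strip_of_abs_im_le {ζ : ℂ} (h : |ζ.im| ≤ Real.pi) : ζ ∈ strip := by
  simp only [strip, mem_ofPred_eq]; linarith [Real.pi_pos]

/-- The numerator of the derivative of `ζ ↦ B (exp ζ)`. -/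
noncomputable def phiNum (ζ : ℂ) : ℂ := (Complex.exp ζ / 2 - ζ / Real.pi) * Complex.exp ζ

/-- The denominator of the derivative of `ζ ↦ B (exp ζ)`. -/
noncomputable def phiDen (ζ : ℂ) : ℂ := 1 + Complex.exp ζ ^ 2

/-- The derivative of `ζ ↦ B (exp ζ)`, continued to `strip`. -/
noncomputable def phi : ℂ → ℂ := quotExt phiNum phiDen

lemma hasDerivAt_phiNum (ζ : ℂ) : HasDerivAt phiNum
    ((Complex.exp ζ / 2 - 1 / Real.pi) * Complex.exp ζ +
      (Complex.exp ζ / 2 - ζ / Real.pi) * Complex.exp ζ) ζ :=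
  (((Complex.hasDerivAt_exp ζ).div_const 2).sub ((hasDerivAt_id ζ).div_const _)).mul
    (Complex.hasDerivAt_exp ζ)

lemma hasDerivAt_phiDen (ζ : ℂ) : HasDerivAt phiDen (2 * Complex.exp ζ ^ 2) ζ := by
  refine (((Complex.hasDerivAt_exp ζ).pow 2).const_add 1).congr_deriv ?_
  simp; ring

lemma exp_neg_half_pi_mul_I : Complex.exp (-(Real.pi / 2 * I)) = -I := by
  rw [Complex.exp_neg, Complex.exp_pi_div_two_mul_I, Complex.inv_I]

lemma eq_of_phiDen_eq_zero {ζ : ℂ} (hζ : ζ ∈ strip) (h : phiDen ζ = 0) :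
    ζ = Real.pi / 2 * I ∨ ζ = -(Real.pi / 2 * I) := by
  have h2 : (Complex.exp ζ - I) * (Complex.exp ζ + I) = 0 := by
    have := Complex.I_sq
    unfold phiDen at h
    linear_combination h - this
  have hpi : (0 : ℝ) < Real.pi := Real.pi_pos
  have hs : |ζ.im| < 3 * Real.pi / 2 := hζ
  rw [abs_lt] at hs
  rcases mul_eq_zero.1 h2 with h3 | h3
  · left
    have h4 : Complex.exp ζ = Complex.exp (Real.pi / 2 * I) := by
      rw [Complex.exp_pi_div_two_mul_I]; exact sub_eq_zero.1 h3
    obtain ⟨n, hn⟩ := Complex.exp_eq_exp_iff_exists_int.1 h4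
    have him : ζ.im = Real.pi / 2 + n * (2 * Real.pi) := by
      rw [hn]; simp
    have hn1 : (n : ℝ) < 1 := by nlinarith
    have hn2 : (-1 : ℝ) < n := by nlinarith
    have : n = 0 := by
      have a1 : n < 1 := by exact_mod_cast hn1
      have a2 : -1 < n := by exact_mod_cast hn2
      omega
    rw [hn, this]; simp
  · right
    have h4 : Complex.exp ζ = Complex.exp (-(Real.pi / 2 * I)) := by
      rw [exp_neg_half_pi_mul_I]; exact eq_neg_of_add_eq_zero_left h3
    obtain ⟨n, hn⟩ := Complex.exp_eq_exp_iff_exists_int.1 h4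
    have him : ζ.im = -(Real.pi / 2) + n * (2 * Real.pi) := by
      rw [hn]; simp
    have hn1 : (n : ℝ) < 1 := by nlinarith
    have hn2 : (-1 : ℝ) < n := by nlinarith
    have : n = 0 := by
      have a1 : n < 1 := by exact_mod_cast hn1
      have a2 : -1 < n := by exact_mod_cast hn2
      omega
    rw [hn, this]; simp

lemma phiDen_pi_div_two : phiDen (Real.pi / 2 * I) = 0 := by
  rw [phiDen, Complex.exp_pi_div_two_mul_I, Complex.I_sq]; ring

lemma phiDen_neg_pi_div_two : phiDen (-(Real.pi / 2 * I)) = 0 := by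
  rw [phiDen, exp_neg_half_pi_mul_I, neg_sq, Complex.I_sq]; ring

lemma pi_ne_zero_complex : (Real.pi : ℂ) ≠ 0 := by exact_mod_cast Real.pi_ne_zero

lemma deriv_phiDen_ne_zero (ζ : ℂ) : deriv phiDen ζ ≠ 0 := by
  rw [(hasDerivAt_phiDen ζ).deriv]
  simp [Complex.exp_ne_zero]

lemma phi_pi_div_two : phi (Real.pi / 2 * I) = 1 / 4 + I / (2 * Real.pi) := by
  rw [phi, quotExt_of_eq phiDen_pi_div_two, (hasDerivAt_phiNum _).deriv, (hasDerivAt_phiDen _).deriv,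
    Complex.exp_pi_div_two_mul_I]
  have := pi_ne_zero_complex
  field_simp
  ring_nf
  simp only [Complex.I_sq]
  ring

lemma phi_neg_pi_div_two : phi (-(Real.pi / 2 * I)) = 1 / 4 - I / (2 * Real.pi) := by
  rw [phi, quotExt_of_eq phiDen_neg_pi_div_two, (hasDerivAt_phiNum _).deriv,
    (hasDerivAt_phiDen _).deriv, exp_neg_half_pi_mul_I]
  have := pi_ne_zero_complex
  field_simp
  ring_nf
  simp only [Complex.I_sq]
  ring

lemma differentiableOn_phi : DifferentiableOn ℂ phi strip := by
  refine differentiableOn_quotExt isOpen_strip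
    (fun ζ _ => (hasDerivAt_phiNum ζ).differentiableAt.differentiableWithinAt)
    (fun ζ _ => (hasDerivAt_phiDen ζ).differentiableAt.differentiableWithinAt) ?_
  intro ζ hζ h0
  refine ⟨?_, deriv_phiDen_ne_zero ζ⟩
  have := pi_ne_zero_complex
  rcases eq_of_phiDen_eq_zero hζ h0 with rfl | rfl
  · rw [phiNum, Complex.exp_pi_div_two_mul_I]; field_simp; ring
  · rw [phiNum, exp_neg_half_pi_mul_I]; field_simp; ring

lemma phi_of_ne {ζ : ℂ} (h : phiDen ζ ≠ 0) : phi ζ = phiNum ζ / phiDen ζ := quotExt_of_ne h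

lemma phi_add_phi_neg {ζ : ℂ} (hζ : ζ ∈ strip) : phi ζ + phi (-ζ) = 1 / 2 := by
  by_cases h0 : phiDen ζ = 0
  · rcases eq_of_phiDen_eq_zero hζ h0 with rfl | rfl
    · rw [phi_neg_pi_div_two, phi_pi_div_two]; ring
    · rw [neg_neg, phi_neg_pi_div_two, phi_pi_div_two]; ring
  · have he := Complex.exp_ne_zero ζ
    have h1 : phiDen (-ζ) = phiDen ζ / Complex.exp ζ ^ 2 := by
      rw [phiDen, phiDen, Complex.exp_neg]; field_simp; ring
    have h2 : phiDen (-ζ) ≠ 0 := by rw [h1]; exact div_ne_zero h0 (pow_ne_zero _ he)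
    rw [phi_of_ne h0, phi_of_ne h2, h1, phiNum, phiNum, Complex.exp_neg]
    have := pi_ne_zero_complex
    field_simp
    rw [phiDen]
    ring

lemma phi_add_phi_shift (x : ℝ) :
    phi (x + Real.pi / 2 * I) + phi (x + -(Real.pi / 2 * I)) =
      Complex.exp x / (1 + Complex.exp x) := by
  by_cases hx : x = 0
  · subst hx
    simp only [Complex.ofReal_zero, zero_add, phi_pi_div_two, phi_neg_pi_div_two, Complex.exp_zero]
    ring
  · have e1 : phiDen (x + Real.pi / 2 * I) = (1 - Complex.exp x) * (1 + Complex.exp x) := by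
      rw [phiDen, Complex.exp_add, Complex.exp_pi_div_two_mul_I, mul_pow, Complex.I_sq]; ring
    have e2 : phiDen (x + -(Real.pi / 2 * I)) = (1 - Complex.exp x) * (1 + Complex.exp x) := by
      rw [phiDen, Complex.exp_add, exp_neg_half_pi_mul_I, mul_pow, neg_sq, Complex.I_sq]; ring
    have n1 : 1 - Complex.exp x ≠ 0 := by
      rw [← Complex.ofReal_exp]
      norm_cast
      rw [sub_eq_zero, eq_comm, Real.exp_eq_one_iff]
      exact hx
    have n2 : 1 + Complex.exp x ≠ 0 := by
      rw [← Complex.ofReal_exp]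
      norm_cast
      positivity
    have n3 := mul_ne_zero n1 n2
    rw [phi_of_ne (by rwa [e1]), phi_of_ne (by rwa [e2]), e1, e2, phiNum, phiNum, Complex.exp_add,
      Complex.exp_add, Complex.exp_pi_div_two_mul_I, exp_neg_half_pi_mul_I]
    have := pi_ne_zero_complex
    field_simp
    ring_nf
    simp only [Complex.I_sq]
    ring

/-- `Re ζ → -∞` within `|Im ζ| ≤ π`. -/
def leftEnd : Filter ℂ := comap Complex.re atBot ⊓ 𝓟 {ζ | |ζ.im| ≤ Real.pi}

/-- `Re ζ → +∞` within `|Im ζ| ≤ π`. -/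
def rightEnd : Filter ℂ := comap Complex.re atTop ⊓ 𝓟 {ζ | |ζ.im| ≤ Real.pi}

lemma tendsto_re_leftEnd : Tendsto Complex.re leftEnd atBot := tendsto_comap.mono_left inf_le_left

lemma tendsto_re_rightEnd : Tendsto Complex.re rightEnd atTop := tendsto_comap.mono_left inf_le_left

lemma eventually_im_leftEnd : ∀ᶠ ζ in leftEnd, |ζ.im| ≤ Real.pi :=
  eventually_inf_principal.2 (Eventually.of_forall fun _ h => h)

lemma eventually_im_rightEnd : ∀ᶠ ζ in rightEnd, |ζ.im| ≤ Real.pi :=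
  eventually_inf_principal.2 (Eventually.of_forall fun _ h => h)

lemma tendsto_neg_rightEnd : Tendsto (fun ζ : ℂ => -ζ) rightEnd leftEnd := by
  refine tendsto_inf.2 ⟨tendsto_comap_iff.2 ?_, tendsto_principal.2 ?_⟩
  · exact tendsto_neg_atTop_atBot.comp tendsto_re_rightEnd
  · filter_upwards [eventually_im_rightEnd] with ζ h
    simpa using h

lemma tendsto_add_mul_I_leftEnd {y : ℝ} (hy : |y| ≤ Real.pi) :
    Tendsto (fun x : ℝ => (x : ℂ) + y * I) atBot leftEnd := by
  refine tendsto_inf.2 ⟨tendsto_comap_iff.2 ?_, tendsto_principal.2 ?_⟩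
  · have : (Complex.re ∘ fun x : ℝ => (x : ℂ) + y * I) = id := by ext x; simp
    rw [this]; exact tendsto_id
  · exact Eventually.of_forall fun x => by simpa using hy

lemma tendsto_exp_leftEnd : Tendsto Complex.exp leftEnd (𝓝 0) := by
  rw [tendsto_zero_iff_norm_tendsto_zero]
  simp only [Complex.norm_exp]
  exact Real.tendsto_exp_atBot.comp tendsto_re_leftEnd

lemma tendsto_mul_exp_leftEnd : Tendsto (fun ζ => ζ * Complex.exp ζ) leftEnd (𝓝 0) := by
  have h1 : Tendsto (fun x : ℝ => (-x + Real.pi) * Real.exp x) atBot (𝓝 0) := by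
    have a := (Real.tendsto_pow_mul_exp_neg_atTop_nhds_zero 1).comp tendsto_neg_atBot_atTop
    have b := Real.tendsto_exp_atBot.const_mul Real.pi
    have c := a.add b
    simp only [mul_zero, add_zero] at c
    refine c.congr fun x => ?_
    simp
    ring
  refine squeeze_zero_norm' ?_ (h1.comp tendsto_re_leftEnd)
  filter_upwards [eventually_im_leftEnd, tendsto_re_leftEnd.eventually (eventually_le_atBot 0)]
    with ζ h1 h2
  rw [norm_mul, Complex.norm_exp]
  have := Complex.norm_le_abs_re_add_abs_im ζ
  rw [abs_of_nonpos h2] at this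
  exact mul_le_mul_of_nonneg_right (by linarith) (Real.exp_pos _).le

lemma tendsto_phi_leftEnd : Tendsto phi leftEnd (𝓝 0) := by
  have hD : Tendsto phiDen leftEnd (𝓝 1) := by
    have h := (tendsto_exp_leftEnd.pow 2).const_add 1
    simp only [ne_eq, OfNat.ofNat_ne_zero, not_false_eq_true, zero_pow, add_zero] at h
    exact h
  have hN : Tendsto phiNum leftEnd (𝓝 0) := by
    have := ((tendsto_exp_leftEnd.pow 2).div_const 2).sub
      (tendsto_mul_exp_leftEnd.div_const (Real.pi : ℂ))
    simp only [ne_eq, OfNat.ofNat_ne_zero, not_false_eq_true, zero_pow, zero_div, sub_zero] at this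
    refine this.congr fun ζ => ?_
    rw [phiNum]; ring
  have h := hN.div hD one_ne_zero
  rw [zero_div] at h
  refine h.congr' ?_
  filter_upwards [hD.eventually_ne one_ne_zero] with ζ hζ
  exact (phi_of_ne hζ).symm

lemma integrable_one_div_one_add_sq : Integrable fun s : ℝ => 1 / (1 + s ^ 2) := by
  simpa using integrable_inv_one_add_sq

lemma continuous_one_div_one_add_sq : Continuous fun s : ℝ => 1 / (1 + s ^ 2) :=
  continuous_const.div (by fun_prop) fun s => by positivity

lemma integrableOn_log_div_one_add_sq :
    IntegrableOn (fun s : ℝ => Real.log s / (1 + s ^ 2)) (Ioi 0) := by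
  have hm : Measurable (fun s : ℝ => Real.log s / (1 + s ^ 2)) := by fun_prop
  rw [← Ioc_union_Ioi_eq_Ioi zero_le_one]
  refine IntegrableOn.union ?_ ?_
  · have h : IntegrableOn Real.log (Ioc 0 1) :=
      (intervalIntegrable_iff_integrableOn_Ioc_of_le zero_le_one).1
        intervalIntegral.intervalIntegrable_log'
    refine Integrable.mono h hm.aestronglyMeasurable (ae_of_all _ fun s => ?_)
    rw [norm_div]
    refine div_le_self (norm_nonneg _) ?_
    rw [Real.norm_of_nonneg (by positivity)]
    nlinarith [sq_nonneg s]
  · have h : IntegrableOn (fun s : ℝ => 2 * s ^ (-(3 / 2) : ℝ)) (Ioi 1) :=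
      (integrableOn_Ioi_rpow_of_lt (by norm_num) one_pos).const_mul 2
    refine h.mono' hm.aestronglyMeasurable ((ae_restrict_mem measurableSet_Ioi).mono fun s hs => ?_)
    have hs1 : (1 : ℝ) < s := hs
    have hs0 : (0 : ℝ) < s := by linarith
    have h1 : Real.log s ≤ s ^ (1 / 2 : ℝ) / (1 / 2) := Real.log_le_rpow_div hs0.le (by norm_num)
    have h2 : s ^ (-(3 / 2) : ℝ) = s ^ (1 / 2 : ℝ) / s ^ 2 := by
      rw [← Real.rpow_natCast s 2, ← Real.rpow_sub hs0]; norm_num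
    rw [Real.norm_of_nonneg (div_nonneg (Real.log_nonneg hs1.le) (by positivity)), h2,
      ← mul_div_assoc]
    have : 0 ≤ s ^ (1 / 2 : ℝ) := by positivity
    gcongr
    · linarith
    · linarith

lemma integral_log_div_one_add_sq : ∫ s in Ioi (0 : ℝ), Real.log s / (1 + s ^ 2) = 0 := by
  have h := integral_comp_rpow_Ioi (fun s : ℝ => Real.log s / (1 + s ^ 2)) (p := -1) (by norm_num)
  have h2 : ∫ s in Ioi (0 : ℝ), (|(-1 : ℝ)| * s ^ ((-1 : ℝ) - 1)) •
      (Real.log (s ^ (-1 : ℝ)) / (1 + (s ^ (-1 : ℝ)) ^ 2)) =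
      ∫ s in Ioi (0 : ℝ), -(Real.log s / (1 + s ^ 2)) := by
    refine setIntegral_congr_fun measurableSet_Ioi fun s hs => ?_
    have hs0 : (0 : ℝ) < s := hs
    have e1 : s ^ ((-1 : ℝ) - 1) = (s ^ 2)⁻¹ := by
      rw [← Real.rpow_natCast s 2, ← Real.rpow_neg hs0.le]; norm_num
    simp only [e1, Real.rpow_neg_one, Real.log_inv, smul_eq_mul, abs_neg, abs_one]
    field_simp
    ring
  rw [h2, integral_neg] at h
  linarith

lemma abs_log_add_le {x s : ℝ} (hx : 0 ≤ x) (hx1 : x ≤ 1) (hs : 0 < s) :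
    |Real.log (x + s)| ≤ Real.log 2 + |Real.log s| := by
  have h2 : 0 ≤ Real.log 2 := Real.log_nonneg (by norm_num)
  rw [abs_le]
  constructor
  · have : Real.log s ≤ Real.log (x + s) := Real.log_le_log hs (by linarith)
    linarith [neg_abs_le (Real.log s)]
  · rcases le_total s 1 with h | h
    · have : Real.log (x + s) ≤ Real.log 2 := Real.log_le_log (by linarith) (by linarith)
      linarith [abs_nonneg (Real.log s)]
    · have : Real.log (x + s) ≤ Real.log (2 * s) := Real.log_le_log (by linarith) (by linarith)
      rw [Real.log_mul two_ne_zero hs.ne'] at this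
      linarith [le_abs_self (Real.log s)]

lemma integrableOn_const_add_abs_log_div (c : ℝ) :
    IntegrableOn (fun s : ℝ => (c + |Real.log s|) / (1 + s ^ 2)) (Ioi 0) := by
  have h1 := (integrable_one_div_one_add_sq.const_mul c).integrableOn (s := Ioi 0)
  refine (h1.add integrableOn_log_div_one_add_sq.norm).congr (ae_of_all _ fun s => ?_)
  simp only [Pi.add_apply, norm_div, Real.norm_eq_abs]
  rw [abs_of_nonneg (by positivity : 0 ≤ 1 + s ^ 2)]
  ring

lemma norm_div_one_add_sq (a : ℂ) (s : ℝ) : ‖a / (1 + (s : ℂ) ^ 2)‖ = ‖a‖ / (1 + s ^ 2) := by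
  have : (1 + (s : ℂ) ^ 2) = ((1 + s ^ 2 : ℝ) : ℂ) := by push_cast; rfl
  rw [norm_div, this, Complex.norm_of_nonneg (by positivity)]

lemma Bfun_eq (z : ℂ) : Bfun z =
    (1 / (Real.pi : ℂ)) * ∫ s in Ioi (0 : ℝ), Complex.log (z + s) / (1 + (s : ℂ) ^ 2) := by
  rw [Bfun]
  congr 1
  have h := integral_comp_neg_Ioi 0 (fun s : ℝ => Complex.log (z - (s : ℂ)) / (1 + (s : ℂ) ^ 2))
  rw [neg_zero] at h
  rw [← integral_Iic_eq_integral_Iio, ← h]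
  refine integral_congr_ae (ae_of_all _ fun s => ?_)
  simp

lemma aestronglyMeasurable_log_div (w : ℂ) : AEStronglyMeasurable
    (fun s : ℝ => Complex.log (w + s) / (1 + (s : ℂ) ^ 2)) (volume.restrict (Ioi 0)) := by
  have : Measurable (fun s : ℝ => Complex.log (w + s) / (1 + (s : ℂ) ^ 2)) := by fun_prop
  exact this.aestronglyMeasurable

lemma tendsto_Bfun_ofReal : Tendsto (fun x : ℝ => Bfun x) (𝓝[>] 0) (𝓝 0) := by
  have h : Tendsto (fun x : ℝ => ∫ s in Ioi (0 : ℝ), Complex.log ((x : ℂ) + s) / (1 + (s : ℂ) ^ 2))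
      (𝓝[>] 0) (𝓝 (∫ s in Ioi (0 : ℝ), Complex.log (s : ℂ) / (1 + (s : ℂ) ^ 2))) := by
    refine tendsto_integral_filter_of_dominated_convergence _ 
      (Eventually.of_forall fun x => aestronglyMeasurable_log_div x) ?_
      (integrableOn_const_add_abs_log_div (Real.log 2)) ?_
    · filter_upwards [Ioo_mem_nhdsGT (zero_lt_one' ℝ)] with x hx
      refine (ae_restrict_mem measurableSet_Ioi).mono fun s hs => ?_
      have hs0 : (0 : ℝ) < s := hs
      rw [norm_div_one_add_sq, ← Complex.ofReal_add, ← Complex.ofReal_log (by linarith [hx.1]),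
        Complex.norm_real, Real.norm_eq_abs]
      gcongr
      exact abs_log_add_le hx.1.le hx.2.le hs0
    · refine (ae_restrict_mem measurableSet_Ioi).mono fun s hs => ?_
      have hs0 : (0 : ℝ) < s := hs
      have hc : ContinuousAt (fun x : ℝ => Complex.log ((x : ℂ) + s) / (1 + (s : ℂ) ^ 2)) 0 := by
        refine ContinuousAt.div_const (ContinuousAt.clog (by fun_prop) ?_) _
        left; simpa using hs0
      simpa using hc.tendsto.mono_left nhdsWithin_le_nhds
  have h0 : ∫ s in Ioi (0 : ℝ), Complex.log (s : ℂ) / (1 + (s : ℂ) ^ 2) = 0 := by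
    have : ∫ s in Ioi (0 : ℝ), Complex.log (s : ℂ) / (1 + (s : ℂ) ^ 2) =
        ∫ s in Ioi (0 : ℝ), ((Real.log s / (1 + s ^ 2) : ℝ) : ℂ) := by
      refine setIntegral_congr_fun measurableSet_Ioi fun s hs => ?_
      have hs0 : (0 : ℝ) < s := hs
      rw [← Complex.ofReal_log hs0.le]
      push_cast; rfl
    rw [this, integral_complex_ofReal, integral_log_div_one_add_sq, Complex.ofReal_zero]
  rw [h0] at h
  have h3 := h.const_mul (1 / (Real.pi : ℂ))
  rw [mul_zero] at h3
  exact h3.congr fun x => (Bfun_eq x).symm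

lemma norm_log_add_le {w : ℂ} (hw : 0 < w.re) {s : ℝ} (hs : 0 < s) :
    ‖Complex.log (w + s)‖ ≤
      |Real.log w.re| + |Real.log (‖w‖ + 1)| + Real.pi + Real.log 2 + |Real.log s| := by
  have hre : w.re + s ≤ ‖w + s‖ := by
    have := Complex.re_le_norm (w + s); simpa using this
  have hub : ‖w + s‖ ≤ (‖w‖ + 1) * (1 + s) := by
    have h1 := norm_add_le w (s : ℂ)
    rw [Complex.norm_of_nonneg hs.le] at h1
    nlinarith [norm_nonneg w]
  have hpos : 0 < ‖w + s‖ := by linarith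
  have h1 : Real.log w.re ≤ Real.log ‖w + s‖ := Real.log_le_log hw (by linarith)
  have h2 : Real.log ‖w + s‖ ≤ Real.log (‖w‖ + 1) + Real.log (1 + s) := by
    rw [← Real.log_mul (by positivity) (by positivity)]
    exact Real.log_le_log hpos hub
  have h3 := abs_log_add_le zero_le_one le_rfl hs
  have h4 := Complex.norm_le_abs_re_add_abs_im (Complex.log (w + s))
  rw [Complex.log_re, Complex.log_im] at h4
  have h5 := Complex.abs_arg_le_pi (w + s)
  have h6 : |Real.log ‖w + s‖| ≤
      |Real.log w.re| + |Real.log (‖w‖ + 1)| + (Real.log 2 + |Real.log s|) := by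
    rw [abs_le]
    have a1 := neg_abs_le (Real.log w.re)
    have a2 := abs_nonneg (Real.log w.re)
    have a3 := le_abs_self (Real.log (‖w‖ + 1))
    have a4 := abs_nonneg (Real.log (‖w‖ + 1))
    have a5 := le_abs_self (Real.log (1 + s))
    have a6 := abs_nonneg (Real.log (1 + s))
    constructor <;> linarith
  linarith

lemma one_add_sq_ne_zero {w : ℂ} (hw : 0 < w.re) : 1 + w ^ 2 ≠ 0 := by
  intro h
  have h2 : (w - I) * (w + I) = 0 := by
    have := Complex.I_sq
    linear_combination h - this
  rcases mul_eq_zero.1 h2 with h3 | h3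
  · have := congrArg Complex.re h3; simp at this; linarith
  · have := congrArg Complex.re h3; simp at this; linarith

lemma tendsto_log_add_sub (w : ℂ) : Tendsto (fun s : ℝ =>
    Complex.log (w + s) - ((1 / 2 * Real.log (1 + s ^ 2) : ℝ) : ℂ)) atTop (𝓝 0) := by
  have h1 : Tendsto (fun s : ℝ => Complex.log (1 + w * ((s⁻¹ : ℝ) : ℂ))) atTop (𝓝 0) := by
    have a : Tendsto (fun s : ℝ => ((s⁻¹ : ℝ) : ℂ)) atTop (𝓝 ((0 : ℝ) : ℂ)) :=
      (Complex.continuous_ofReal.tendsto 0).comp tendsto_inv_atTop_zero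
    have b := (a.const_mul w).const_add 1
    simp only [Complex.ofReal_zero, mul_zero, add_zero] at b
    simpa using b.clog (by simp)
  have h2 : Tendsto (fun s : ℝ => ((1 / 2 * Real.log (1 + s⁻¹ ^ 2) : ℝ) : ℂ)) atTop (𝓝 0) := by
    have b := ((tendsto_inv_atTop_zero (𝕜 := ℝ)).pow 2).const_add 1
    have c := ((b.log (by simp)).const_mul (1 / 2))
    simp only [ne_eq, OfNat.ofNat_ne_zero, not_false_eq_true, zero_pow, add_zero, Real.log_one,
      mul_zero] at c
    have := (Complex.continuous_ofReal.tendsto 0).comp c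
    rwa [Complex.ofReal_zero] at this
  have h3 := h1.sub h2
  rw [sub_zero] at h3
  have hne : ∀ᶠ s : ℝ in atTop, 1 + w * ((s⁻¹ : ℝ) : ℂ) ≠ 0 := by
    have a : Tendsto (fun s : ℝ => ((s⁻¹ : ℝ) : ℂ)) atTop (𝓝 ((0 : ℝ) : ℂ)) :=
      (Complex.continuous_ofReal.tendsto 0).comp tendsto_inv_atTop_zero
    have b := (a.const_mul w).const_add 1
    simp only [Complex.ofReal_zero, mul_zero, add_zero] at b
    exact b.eventually_ne one_ne_zero
  refine h3.congr' ?_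
  filter_upwards [eventually_gt_atTop 0, hne] with s hs hne
  have e1 : w + s = (s : ℂ) * (1 + w * ((s⁻¹ : ℝ) : ℂ)) := by
    have : (s : ℂ) ≠ 0 := by exact_mod_cast hs.ne'
    push_cast; field_simp; ring
  have e2 : 1 + s ^ 2 = s ^ 2 * (1 + s⁻¹ ^ 2) := by field_simp; ring
  rw [e1, Complex.log_ofReal_mul hs hne, e2, Real.log_mul (by positivity) (by positivity),
    Real.log_pow]
  push_cast
  ring

lemma hasDerivAt_Bfun {w : ℂ} (hw : 0 < w.re) :
    HasDerivAt Bfun ((w / 2 - Complex.log w / Real.pi) / (1 + w ^ 2)) w := by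
  have hnhds : {v : ℂ | w.re / 2 < v.re} ∈ 𝓝 w :=
    (isOpen_lt continuous_const Complex.continuous_re).mem_nhds (by simp; linarith)
  obtain ⟨hint, hder⟩ := hasDerivAt_integral_of_dominated_loc_of_deriv_le
    (μ := volume.restrict (Ioi (0 : ℝ))) (x₀ := w)
    (F := fun v (s : ℝ) => Complex.log (v + s) / (1 + (s : ℂ) ^ 2))
    (F' := fun v (s : ℝ) => (v + s)⁻¹ / (1 + (s : ℂ) ^ 2))
    (bound := fun s => (w.re / 2)⁻¹ * (1 / (1 + s ^ 2))) hnhds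
    (Eventually.of_forall fun v => aestronglyMeasurable_log_div v)
    (by
      refine (integrableOn_const_add_abs_log_div
        (|Real.log w.re| + |Real.log (‖w‖ + 1)| + Real.pi + Real.log 2)).mono'
        (aestronglyMeasurable_log_div w) ((ae_restrict_mem measurableSet_Ioi).mono fun s hs => ?_)
      rw [norm_div_one_add_sq]
      gcongr
      exact norm_log_add_le hw hs)
    (by
      have : Measurable (fun s : ℝ => (w + s)⁻¹ / (1 + (s : ℂ) ^ 2)) := by fun_prop
      exact this.aestronglyMeasurable)
    (by
      refine (ae_restrict_mem measurableSet_Ioi).mono fun s hs v hv => ?_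
      have hs0 : (0 : ℝ) < s := hs
      have hv' : w.re / 2 < v.re := hv
      rw [norm_div_one_add_sq, ← mul_one_div, norm_inv]
      gcongr
      have := Complex.re_le_norm (v + s)
      simp at this
      linarith)
    (integrable_one_div_one_add_sq.integrableOn.const_mul _)
    (by
      refine (ae_restrict_mem measurableSet_Ioi).mono fun s hs v hv => ?_
      have hs0 : (0 : ℝ) < s := hs
      have hv' : w.re / 2 < v.re := hv
      have hsl : v + s ∈ slitPlane := by left; simp; linarith
      have := (((hasDerivAt_id v).add_const (s : ℂ)).clog hsl).div_const (1 + (s : ℂ) ^ 2)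
      simpa using this)
  have hne := one_add_sq_ne_zero hw
  have hval : ∫ s in Ioi (0 : ℝ), (w + s)⁻¹ / (1 + (s : ℂ) ^ 2) =
      (Real.pi / 2 * w - Complex.log w) / (1 + w ^ 2) := by
    set G : ℝ → ℂ := fun s => (Complex.log (w + s) - ((1 / 2 * Real.log (1 + s ^ 2) : ℝ) : ℂ) +
      w * (Real.arctan s : ℝ)) / (1 + w ^ 2) with hG
    have hlim : Tendsto G atTop (𝓝 ((0 + w * ((Real.pi / 2 : ℝ) : ℂ)) / (1 + w ^ 2))) := by
      refine Tendsto.div_const ((tendsto_log_add_sub w).add (Tendsto.const_mul w ?_)) _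
      exact (Complex.continuous_ofReal.tendsto _).comp
        (tendsto_nhds_of_tendsto_nhdsWithin tendsto_arctan_atTop)
    have hd : ∀ s ∈ Ici (0 : ℝ), HasDerivAt G ((w + s)⁻¹ / (1 + (s : ℂ) ^ 2)) s := by
      intro s hs
      have hs0 : (0 : ℝ) ≤ s := hs
      have hsl : w + s ∈ slitPlane := by left; simp; linarith
      have hpos : (0 : ℝ) < 1 + s ^ 2 := by positivity
      have d1 : HasDerivAt (fun s : ℝ => Complex.log (w + s)) (1 / (w + s)) s :=
        ((Complex.ofRealCLM.hasDerivAt (x := s)).const_add w).clog_real hsl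
      have d2 : HasDerivAt (fun s : ℝ => 1 / 2 * Real.log (1 + s ^ 2)) (s / (1 + s ^ 2)) s := by
        have := ((((hasDerivAt_id s).pow 2).const_add 1).log hpos.ne').const_mul (1 / 2)
        refine this.congr_deriv ?_
        simp
        field_simp
      have d3 := Real.hasDerivAt_arctan s
      have d := ((d1.sub d2.ofReal_comp).add (d3.ofReal_comp.const_mul w)).div_const (1 + w ^ 2)
      refine d.congr_deriv ?_
      have n1 : w + s ≠ 0 := slitPlane_ne_zero hsl
      have n2 : 1 + (s : ℂ) ^ 2 ≠ 0 := by exact_mod_cast hpos.ne'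
      push_cast
      field_simp
      ring
    rw [integral_Ioi_of_hasDerivAt_of_tendsto' hd hint hlim, hG]
    simp
    field_simp
  have hB : Bfun = fun v => (1 / (Real.pi : ℂ)) *
      ∫ s in Ioi (0 : ℝ), Complex.log (v + s) / (1 + (s : ℂ) ^ 2) := funext Bfun_eq
  rw [hB]
  refine (hder.const_mul _).congr_deriv ?_
  rw [hval]
  have := pi_ne_zero_complex
  field_simp

lemma eqOn_of_hasDerivAt {U : Set ℂ} (hU : IsOpen U) (hconv : Convex ℝ U) {f g f' : ℂ → ℂ}
    (hf : ∀ z ∈ U, HasDerivAt f (f' z) z) (hg : ∀ z ∈ U, HasDerivAt g (f' z) z)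
    {a : ℂ} (ha : a ∈ U) (hfg : f a = g a) : EqOn f g U :=
  hU.eqOn_of_deriv_eq hconv.isPreconnected
    (fun z hz => (hf z hz).differentiableAt.differentiableWithinAt)
    (fun z hz => (hg z hz).differentiableAt.differentiableWithinAt)
    (fun z hz => (hf z hz).deriv.trans (hg z hz).deriv.symm) ha hfg

lemma exists_Phi : ∃ F : ℂ → ℂ, (∀ ζ ∈ strip, HasDerivAt F (phi ζ) ζ) ∧ F 0 = Bfun 1 := by
  obtain ⟨F, hF⟩ := exists_primitive_of_starConvex isOpen_strip
    (convex_strip.starConvex zero_mem_strip) differentiableOn_phi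
  refine ⟨fun ζ => F ζ + (Bfun 1 - F 0), fun ζ hζ => (hF ζ hζ).add_const _, by ring⟩

/-- The holomorphic continuation of `ζ ↦ B (exp ζ)` to `strip`. -/
noncomputable def Phi : ℂ → ℂ := exists_Phi.choose

lemma hasDerivAt_Phi {ζ : ℂ} (hζ : ζ ∈ strip) : HasDerivAt Phi (phi ζ) ζ :=
  exists_Phi.choose_spec.1 ζ hζ

lemma Phi_zero : Phi 0 = Bfun 1 := exists_Phi.choose_spec.2

lemma log_mem_strip (w : ℂ) : Complex.log w ∈ strip :=
  mem_strip_of_abs_im_le (by rw [Complex.log_im]; exact Complex.abs_arg_le_pi w)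

lemma Phi_log {w : ℂ} (hw : 0 < w.re) : Phi (Complex.log w) = Bfun w := by
  have hU : IsOpen {v : ℂ | 0 < v.re} := isOpen_lt continuous_const Complex.continuous_re
  refine eqOn_of_hasDerivAt (f := fun w => Phi (Complex.log w)) hU (convex_halfSpace_re_gt 0) ?_
    (fun v hv => hasDerivAt_Bfun hv) (a := 1) (by simp) (by simp [Phi_zero]) hw
  intro v hv
  have hv0 : 0 < v.re := hv
  have hvsl : v ∈ slitPlane := Or.inl hv0
  have hv1 : v ≠ 0 := slitPlane_ne_zero hvsl
  have h1 := (hasDerivAt_Phi (log_mem_strip v)).comp v (Complex.hasDerivAt_log hvsl)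
  refine h1.congr_deriv ?_
  have h2 : phiDen (Complex.log v) = 1 + v ^ 2 := by rw [phiDen, Complex.exp_log hv1]
  have h3 := one_add_sq_ne_zero hv0
  rw [phi_of_ne (by rwa [h2]), h2, phiNum, Complex.exp_log hv1]
  field_simp

lemma Phi_ofReal (x : ℝ) : Phi x = Bfun (Real.exp x : ℝ) := by
  rw [← Phi_log (w := (Real.exp x : ℝ)) (by rw [Complex.ofReal_re]; exact Real.exp_pos x),
    ← Complex.ofReal_log (Real.exp_pos x).le, Real.log_exp]

lemma eventually_leftEnd {p : ℂ → Prop} :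
    (∀ᶠ ζ in leftEnd, p ζ) ↔ ∃ a : ℝ, ∀ ζ : ℂ, ζ.re ≤ a → |ζ.im| ≤ Real.pi → p ζ := by
  rw [leftEnd, eventually_inf_principal, (atBot_basis.comap Complex.re).eventually_iff]
  simp

lemma eventually_rightEnd {p : ℂ → Prop} :
    (∀ᶠ ζ in rightEnd, p ζ) ↔ ∃ a : ℝ, ∀ ζ : ℂ, a ≤ ζ.re → |ζ.im| ≤ Real.pi → p ζ := by
  rw [rightEnd, eventually_inf_principal, (atTop_basis.comap Complex.re).eventually_iff]
  simp

lemma tendsto_Phi_leftEnd : Tendsto Phi leftEnd (𝓝 0) := by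
  have h1 : Tendsto (fun ζ : ℂ => Phi (ζ.re : ℂ)) leftEnd (𝓝 0) := by
    have : Tendsto (fun x : ℝ => Phi x) atBot (𝓝 0) := by
      simp only [Phi_ofReal]
      exact tendsto_Bfun_ofReal.comp Real.tendsto_exp_atBot_nhdsGT
    exact this.comp tendsto_re_leftEnd
  have h2 : Tendsto (fun ζ : ℂ => Phi ζ - Phi (ζ.re : ℂ)) leftEnd (𝓝 0) := by
    rw [Metric.tendsto_nhds]
    intro ε hε
    have hδ : 0 < ε / (2 * Real.pi) := by have := Real.pi_pos; positivity
    obtain ⟨a, ha⟩ := eventually_leftEnd.1 (Metric.tendsto_nhds.1 tendsto_phi_leftEnd _ hδ)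
    refine eventually_leftEnd.2 ⟨a, fun ζ hre him => ?_⟩
    have hs : Convex ℝ {ζ : ℂ | ζ.re ≤ a ∧ |ζ.im| ≤ Real.pi} := by
      have e : {ζ : ℂ | ζ.re ≤ a ∧ |ζ.im| ≤ Real.pi} =
          Complex.reLm ⁻¹' Iic a ∩ Complex.imLm ⁻¹' Icc (-Real.pi) Real.pi := by
        ext z; simp [abs_le]
      rw [e]
      exact ((convex_Iic a).linear_preimage _).inter ((convex_Icc _ _).linear_preimage _)
    have hb := hs.norm_image_sub_le_of_norm_hasDerivWithin_le (f := Phi) (f' := phi)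
      (C := ε / (2 * Real.pi)) (x := (ζ.re : ℂ)) (y := ζ)
      (fun z hz => (hasDerivAt_Phi (mem_strip_of_abs_im_le hz.2)).hasDerivWithinAt)
      (fun z hz => by simpa using (ha z hz.1 hz.2).le)
      ⟨by simpa using hre, by simpa using Real.pi_pos.le⟩ ⟨hre, him⟩
    have hn : ‖ζ - ζ.re‖ ≤ Real.pi := by
      have : ζ - ζ.re = ζ.im * I := by
        rw [sub_eq_iff_eq_add, add_comm]; exact (Complex.re_add_im ζ).symm
      rw [this, norm_mul, Complex.norm_I, mul_one, Complex.norm_real]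
      exact him
    rw [dist_zero_right]
    calc _ ≤ ε / (2 * Real.pi) * ‖ζ - ζ.re‖ := hb
      _ ≤ ε / (2 * Real.pi) * Real.pi := by gcongr
      _ = ε / 2 := by field_simp
      _ < ε := by linarith
  simpa using h1.add h2

lemma Phi_sub_Phi_neg {ζ : ℂ} (hζ : ζ ∈ strip) : Phi ζ - Phi (-ζ) = ζ / 2 := by
  refine eqOn_of_hasDerivAt (f := fun ζ => Phi ζ - Phi (-ζ)) (g := fun ζ => ζ / 2)
    (f' := fun _ => 1 / 2) isOpen_strip convex_strip ?_
    (fun z _ => (hasDerivAt_id z).div_const 2) zero_mem_strip (by simp) hζ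
  intro z hz
  have h1 := (hasDerivAt_Phi (neg_mem_strip hz)).comp z (hasDerivAt_neg z)
  refine ((hasDerivAt_Phi hz).sub h1).congr_deriv ?_
  rw [← phi_add_phi_neg hz]
  ring

lemma hasDerivAt_Phi_horizontal {c : ℂ} (hc : c ∈ strip) (x : ℝ) :
    HasDerivAt (fun x : ℝ => Phi (x + c)) (phi (x + c)) x := by
  have hm : (x : ℂ) + c ∈ strip := by simpa [strip] using hc
  have h1 := (hasDerivAt_Phi hm).comp x ((Complex.ofRealCLM.hasDerivAt (x := x)).add_const c)
  refine h1.congr_deriv ?_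
  simp

lemma half_pi_mem_strip : (Real.pi / 2 * I : ℂ) ∈ strip := by
  refine mem_strip_of_abs_im_le ?_
  have : (Real.pi / 2 * I : ℂ).im = Real.pi / 2 := by simp
  rw [this, abs_of_pos (by positivity)]
  linarith [Real.pi_pos]

lemma Phi_add_Phi_shift (x : ℝ) : Phi (x + Real.pi / 2 * I) + Phi (x + -(Real.pi / 2 * I)) =
    (Real.log (1 + Real.exp x) : ℝ) := by
  have hpi := Real.pi_pos
  refine eq_of_hasDerivAt_of_tendsto_atBot (l := 0)
    (f := fun x : ℝ => Phi (x + Real.pi / 2 * I) + Phi (x + -(Real.pi / 2 * I)))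
    (g := fun x : ℝ => ((Real.log (1 + Real.exp x) : ℝ) : ℂ))
    (fun x => (hasDerivAt_Phi_horizontal half_pi_mem_strip x).add
      (hasDerivAt_Phi_horizontal (neg_mem_strip half_pi_mem_strip) x)) ?_ ?_ ?_ x
  · intro x
    rw [phi_add_phi_shift]
    have h := (((Real.hasDerivAt_exp x).const_add 1).log (by positivity)).ofReal_comp
    refine h.congr_deriv ?_
    push_cast
    rfl
  · have h1 := tendsto_Phi_leftEnd.comp (tendsto_add_mul_I_leftEnd (y := Real.pi / 2)
      (by rw [abs_of_pos (by positivity)]; linarith))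
    have h2 := tendsto_Phi_leftEnd.comp (tendsto_add_mul_I_leftEnd (y := -(Real.pi / 2))
      (by rw [abs_neg, abs_of_pos (by positivity)]; linarith))
    have h3 := h1.add h2
    rw [add_zero] at h3
    refine h3.congr fun x => ?_
    simp
  · have h := ((Real.tendsto_exp_atBot.const_add 1).log (by norm_num))
    have h' := (Complex.continuous_ofReal.tendsto _).comp h
    rw [add_zero, Real.log_one, Complex.ofReal_zero] at h'
    exact h'

lemma exp_Phi_half_pi : Complex.exp (Phi (Real.pi / 2 * I)) =
    Real.sqrt 2 * (Real.cos (Real.pi / 8) + Real.sin (Real.pi / 8) * I) := by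
  have h1 := Phi_add_Phi_shift 0
  have h2 := Phi_sub_Phi_neg half_pi_mem_strip
  simp only [Complex.ofReal_zero, zero_add, Real.exp_zero] at h1
  have h3 : Phi (Real.pi / 2 * I) = ((Real.log (Real.sqrt 2) : ℝ) : ℂ) + (Real.pi / 8 : ℝ) * I := by
    rw [Real.log_sqrt (by norm_num)]
    rw [one_add_one_eq_two] at h1
    push_cast at h1 ⊢
    linear_combination h1 / 2 + h2 / 2
  rw [h3, Complex.exp_add, ← Complex.ofReal_exp, Real.exp_log (by positivity), Complex.exp_mul_I,
    Complex.ofReal_cos, Complex.ofReal_sin]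

lemma exp_Phi_neg_half_pi : Complex.exp (Phi (-(Real.pi / 2 * I))) =
    Real.sqrt 2 * (Real.cos (Real.pi / 8) - Real.sin (Real.pi / 8) * I) := by
  have h1 := Phi_add_Phi_shift 0
  have h2 := Phi_sub_Phi_neg half_pi_mem_strip
  simp only [Complex.ofReal_zero, zero_add, Real.exp_zero] at h1
  have h3 : Phi (-(Real.pi / 2 * I)) =
      ((Real.log (Real.sqrt 2) : ℝ) : ℂ) + ((-(Real.pi / 8) : ℝ) : ℂ) * I := by
    rw [Real.log_sqrt (by norm_num)]
    rw [one_add_one_eq_two] at h1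
    push_cast at h1 ⊢
    linear_combination h1 / 2 - h2 / 2
  rw [h3, Complex.exp_add, ← Complex.ofReal_exp, Real.exp_log (by positivity), Complex.exp_mul_I,
    ← Complex.ofReal_cos, ← Complex.ofReal_sin, Real.cos_neg, Real.sin_neg]
  push_cast
  ring

lemma intervalIntegrable_log_div (a b : ℝ) :
    IntervalIntegrable (fun s : ℝ => Real.log |s| / (1 + s ^ 2)) volume a b := by
  have h : IntervalIntegrable Real.log volume a b := intervalIntegral.intervalIntegrable_log'
  refine (h.mul_continuousOn continuous_one_div_one_add_sq.continuousOn).congr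
    fun s _ => ?_
  simp only [Real.log_abs]
  ring

lemma continuous_etaF : Continuous etaF := by
  have h := intervalIntegral.continuous_primitive (μ := volume) intervalIntegrable_log_div 0
  have h2 : Continuous fun t : ℝ => Real.log (1 + t ^ 2) :=
    Continuous.log (by fun_prop) fun t => by positivity
  exact (h2.div_const 4).sub (h.const_mul _)

lemma etaF_zero : etaF 0 = 0 := by simp [etaF]

lemma hasDerivAt_etaF {t : ℝ} (ht : 0 < t) :
    HasDerivAt etaF ((t / 2 - Real.log t / Real.pi) / (1 + t ^ 2)) t := by
  have hpos : 0 < 1 + t ^ 2 := by positivity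
  have hm : Measurable (fun s : ℝ => Real.log |s| / (1 + s ^ 2)) := by fun_prop
  have d1 : HasDerivAt (fun t : ℝ => ∫ s in (0 : ℝ)..t, Real.log |s| / (1 + s ^ 2))
      (Real.log |t| / (1 + t ^ 2)) t := by
    refine intervalIntegral.integral_hasDerivAt_right (intervalIntegrable_log_div 0 t)
      hm.stronglyMeasurable.stronglyMeasurableAtFilter ?_
    refine ContinuousAt.div (ContinuousAt.log (by fun_prop) ?_) (by fun_prop) hpos.ne'
    exact (abs_pos.2 ht.ne').ne'
  have d2 := (((hasDerivAt_id t).pow 2).const_add 1).log hpos.ne'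
  refine ((d2.div_const 4).sub (d1.const_mul (1 / Real.pi))).congr_deriv ?_
  rw [Real.log_abs]
  simp
  field_simp
  ring

lemma exists_exp_neg_etaF_le : ∃ C : ℝ, 0 < C ∧ ∀ t, 0 ≤ t → Real.exp (-etaF t) ≤ C := by
  refine ⟨_, Real.exp_pos ((1 / Real.pi) * ∫ s in Ioi (0 : ℝ), ‖Real.log s / (1 + s ^ 2)‖),
    fun t ht => Real.exp_le_exp.2 ?_⟩
  have h1 : ∫ s in (0 : ℝ)..t, Real.log |s| / (1 + s ^ 2) ≤
      ∫ s in Ioi (0 : ℝ), ‖Real.log s / (1 + s ^ 2)‖ := by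
    rw [intervalIntegral.integral_of_le ht]
    simp only [Real.log_abs]
    calc _ ≤ ∫ s in Ioc (0 : ℝ) t, ‖Real.log s / (1 + s ^ 2)‖ :=
          (Real.le_norm_self _).trans (norm_integral_le_integral_norm _)
      _ ≤ _ := setIntegral_mono_set integrableOn_log_div_one_add_sq.norm
          (ae_of_all _ fun s => norm_nonneg _)
          (ae_of_all _ fun s hs => Ioc_subset_Ioi_self hs)
  have h2 : 0 ≤ Real.log (1 + t ^ 2) := Real.log_nonneg (by nlinarith [sq_nonneg t])
  have h3 : 0 < 1 / Real.pi := by have := Real.pi_pos; positivity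
  have h4 := mul_le_mul_of_nonneg_left h1 h3.le
  rw [etaF]
  linarith

lemma exp_pi_sign {σ : ℝ} (hσ : σ = 1 ∨ σ = -1) : Complex.exp ((σ * Real.pi : ℝ) * I) = -1 := by
  rcases hσ with rfl | rfl
  · simp
  · rw [neg_one_mul, Complex.ofReal_neg, neg_mul, Complex.exp_neg, Complex.exp_pi_mul_I]; norm_num

lemma abs_sign_mul_pi {σ : ℝ} (hσ : σ = 1 ∨ σ = -1) : |σ * Real.pi| ≤ Real.pi := by
  rcases hσ with rfl | rfl <;> simp [abs_of_pos Real.pi_pos]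

lemma sign_mul_pi_mem_strip {σ : ℝ} (hσ : σ = 1 ∨ σ = -1) : ((σ * Real.pi : ℝ) * I : ℂ) ∈ strip := by
  refine mem_strip_of_abs_im_le ?_
  have : (((σ * Real.pi : ℝ) : ℂ) * I).im = σ * Real.pi := by simp
  rw [this]
  exact abs_sign_mul_pi hσ

lemma Phi_boundary {σ : ℝ} (hσ : σ = 1 ∨ σ = -1) (x : ℝ) :
    Phi (x + (σ * Real.pi : ℝ) * I) =
      ((Real.log (1 + Real.exp x ^ 2) / 2 - etaF (Real.exp x) : ℝ) : ℂ) +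
        (σ * Real.arctan (Real.exp x) : ℝ) * I := by
  refine eq_of_hasDerivAt_of_tendsto_atBot (l := 0)
    (f := fun x : ℝ => Phi (x + (σ * Real.pi : ℝ) * I))
    (g := fun x : ℝ => ((Real.log (1 + Real.exp x ^ 2) / 2 - etaF (Real.exp x) : ℝ) : ℂ) +
        (σ * Real.arctan (Real.exp x) : ℝ) * I)
    (fun x => hasDerivAt_Phi_horizontal (sign_mul_pi_mem_strip hσ) x) ?_ ?_ ?_ x
  · intro x
    have hpos : 0 < 1 + Real.exp x ^ 2 := by positivity
    have he := Real.hasDerivAt_exp x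
    have d1 := (((he.fun_pow 2).const_add 1).log hpos.ne').div_const 2
    have d2 := (hasDerivAt_etaF (Real.exp_pos x)).comp x he
    have d3 := (he.arctan).const_mul σ
    refine ((d1.sub d2).ofReal_comp.add (d3.ofReal_comp.mul_const I)).congr_deriv ?_
    have e1 : Complex.exp (x + (σ * Real.pi : ℝ) * I) = -(Real.exp x : ℝ) := by
      rw [Complex.exp_add, exp_pi_sign hσ, Complex.ofReal_exp]; ring
    have e2 : phiDen (x + (σ * Real.pi : ℝ) * I) = ((1 + Real.exp x ^ 2 : ℝ) : ℂ) := by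
      rw [phiDen, e1]; push_cast; ring
    have e3 : ((1 + Real.exp x ^ 2 : ℝ) : ℂ) ≠ 0 := by exact_mod_cast hpos.ne'
    rw [phi_of_ne (by rwa [e2]), phiNum, e2, e1, Real.log_exp]
    have := pi_ne_zero_complex
    push_cast at e3 ⊢
    field_simp
    ring
  · exact tendsto_Phi_leftEnd.comp (tendsto_add_mul_I_leftEnd (abs_sign_mul_pi hσ))
  · have hc : Continuous fun t : ℝ => ((Real.log (1 + t ^ 2) / 2 - etaF t : ℝ) : ℂ) +
        (σ * Real.arctan t : ℝ) * I := by
      have h2 : Continuous fun t : ℝ => Real.log (1 + t ^ 2) :=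
        Continuous.log (by fun_prop) fun t => by positivity
      have h3 := continuous_etaF
      have h4 := Real.continuous_arctan
      fun_prop
    have h := (hc.tendsto 0).comp Real.tendsto_exp_atBot
    simpa [etaF_zero, Function.comp_def] using h

lemma exp_Phi_boundary {σ : ℝ} (hσ : σ = 1 ∨ σ = -1) (x : ℝ) :
    Complex.exp (Phi (x + (σ * Real.pi : ℝ) * I)) =
      Real.exp (-etaF (Real.exp x)) * (1 + σ * Real.exp x * I) := by
  have hpos : 0 < 1 + Real.exp x ^ 2 := by positivity
  have hs : 0 < Real.sqrt (1 + Real.exp x ^ 2) := Real.sqrt_pos.2 hpos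
  rw [Phi_boundary hσ, ← Real.log_sqrt hpos.le, Complex.exp_add, ← Complex.ofReal_exp, sub_eq_add_neg,
    Real.exp_add, Real.exp_log hs, Complex.exp_mul_I, ← Complex.ofReal_cos, ← Complex.ofReal_sin]
  have hcos : Real.cos (σ * Real.arctan (Real.exp x)) = 1 / Real.sqrt (1 + Real.exp x ^ 2) := by
    rcases hσ with rfl | rfl <;> simp [Real.cos_arctan]
  have hsin : Real.sin (σ * Real.arctan (Real.exp x)) =
      σ * Real.exp x / Real.sqrt (1 + Real.exp x ^ 2) := by
    rcases hσ with rfl | rfl <;> simp [Real.sin_arctan, neg_div]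
  rw [hcos, hsin]
  have : (Real.sqrt (1 + Real.exp x ^ 2) : ℂ) ≠ 0 := by exact_mod_cast hs.ne'
  push_cast
  field_simp

/-- The coefficient of `1 + u ^ 2` in `interpPoly`. -/
noncomputable def interpCoeff (w : ℂ) : ℂ :=
  (Complex.exp (Bfun w) - Real.sqrt 2 * (Real.cos (Real.pi / 8) + Real.sin (Real.pi / 8) * w)) /
    (1 + w ^ 2)

/-- The quadratic polynomial taking the values of `exp ∘ B` at `I`, `-I` and `w`. -/
noncomputable def interpPoly (w u : ℂ) : ℂ :=
  interpCoeff w * (1 + u ^ 2) + Real.sqrt 2 * (Real.cos (Real.pi / 8) + Real.sin (Real.pi / 8) * u)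

/-- The numerator of the contour integrand. -/
noncomputable def kerNum (w ζ : ℂ) : ℂ :=
  (Complex.exp (Phi ζ) - interpPoly w (Complex.exp ζ)) * Complex.exp ζ

/-- The denominator of the contour integrand. -/
noncomputable def kerDen (w ζ : ℂ) : ℂ := phiDen ζ * (Complex.exp ζ - w)

/-- The contour integrand. -/
noncomputable def ker (w : ℂ) : ℂ → ℂ := quotExt (kerNum w) (kerDen w)

lemma ker_of_ne {w ζ : ℂ} (h : kerDen w ζ ≠ 0) : ker w ζ = kerNum w ζ / kerDen w ζ :=
  quotExt_of_ne h

lemma interpPoly_I (w : ℂ) : interpPoly w I =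
    Real.sqrt 2 * (Real.cos (Real.pi / 8) + Real.sin (Real.pi / 8) * I) := by
  rw [interpPoly, Complex.I_sq]; ring

lemma interpPoly_neg_I (w : ℂ) : interpPoly w (-I) =
    Real.sqrt 2 * (Real.cos (Real.pi / 8) - Real.sin (Real.pi / 8) * I) := by
  rw [interpPoly, neg_sq, Complex.I_sq]; ring

lemma interpPoly_self {w : ℂ} (hw : 0 < w.re) : interpPoly w w = Complex.exp (Bfun w) := by
  rw [interpPoly, interpCoeff, div_mul_cancel₀ _ (one_add_sq_ne_zero hw)]; ring

lemma eq_log_of_exp_eq {w ζ : ℂ} (hw : 0 < w.re) (hζ : ζ ∈ strip) (h : Complex.exp ζ = w) :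
    ζ = Complex.log w := by
  have hw0 : w ≠ 0 := slitPlane_ne_zero (Or.inl hw)
  have hs : |ζ.im| < 3 * Real.pi / 2 := hζ
  have harg : |w.arg| < Real.pi / 2 := Complex.abs_arg_lt_pi_div_two_iff.2 (Or.inl hw)
  rw [abs_lt] at hs harg
  have hpi := Real.pi_pos
  obtain ⟨n, hn⟩ := Complex.exp_eq_exp_iff_exists_int.1 (h.trans (Complex.exp_log hw0).symm)
  have him : ζ.im = w.arg + n * (2 * Real.pi) := by
    rw [hn]; simp [Complex.log_im]
  have hn1 : (n : ℝ) < 1 := by nlinarith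
  have hn2 : (-1 : ℝ) < n := by nlinarith
  have : n = 0 := by
    have a1 : n < 1 := by exact_mod_cast hn1
    have a2 : -1 < n := by exact_mod_cast hn2
    omega
  rw [hn, this]; simp

lemma hasDerivAt_kerDen (w ζ : ℂ) : HasDerivAt (kerDen w)
    (2 * Complex.exp ζ ^ 2 * (Complex.exp ζ - w) + phiDen ζ * Complex.exp ζ) ζ :=
  (hasDerivAt_phiDen ζ).mul ((Complex.hasDerivAt_exp ζ).sub_const w)

lemma differentiableAt_kerNum (w : ℂ) {ζ : ℂ} (hζ : ζ ∈ strip) :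
    DifferentiableAt ℂ (kerNum w) ζ := by
  have h1 := (hasDerivAt_Phi hζ).differentiableAt
  unfold kerNum interpPoly
  fun_prop

lemma differentiableOn_ker {w : ℂ} (hw : 0 < w.re) : DifferentiableOn ℂ (ker w) strip := by
  refine differentiableOn_quotExt isOpen_strip
    (fun ζ hζ => (differentiableAt_kerNum w hζ).differentiableWithinAt)
    (fun ζ _ => (hasDerivAt_kerDen w ζ).differentiableAt.differentiableWithinAt) ?_
  intro ζ hζ h0
  rw [(hasDerivAt_kerDen w ζ).deriv]
  rcases mul_eq_zero.1 h0 with h1 | h1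
  · rw [h1, zero_mul, add_zero]
    rcases eq_of_phiDen_eq_zero hζ h1 with rfl | rfl
    · refine ⟨by rw [kerNum, Complex.exp_pi_div_two_mul_I, interpPoly_I, exp_Phi_half_pi]; ring, ?_⟩
      rw [Complex.exp_pi_div_two_mul_I]
      refine mul_ne_zero (by simp) fun h => ?_
      have := congrArg Complex.re h
      simp at this
      linarith
    · refine ⟨by
        rw [kerNum, exp_neg_half_pi_mul_I, interpPoly_neg_I, exp_Phi_neg_half_pi]; ring, ?_⟩
      rw [exp_neg_half_pi_mul_I]
      refine mul_ne_zero (by simp) fun h => ?_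
      have := congrArg Complex.re h
      simp at this
      linarith
  · have hw0 : w ≠ 0 := slitPlane_ne_zero (Or.inl hw)
    have h2 := sub_eq_zero.1 h1
    have h3 := eq_log_of_exp_eq hw hζ h2
    refine ⟨?_, ?_⟩
    · rw [kerNum, h2, h3, Phi_log hw, interpPoly_self hw]; ring
    · rw [h1, mul_zero, zero_add, phiDen, h2]
      exact mul_ne_zero (one_add_sq_ne_zero hw) hw0

lemma tendsto_ker_leftEnd {w : ℂ} (hw : 0 < w.re) : Tendsto (ker w) leftEnd (𝓝 0) := by
  have hw0 : w ≠ 0 := slitPlane_ne_zero (Or.inl hw)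
  have he := tendsto_exp_leftEnd
  have hc : Continuous (interpPoly w) := by unfold interpPoly; fun_prop
  have hN : Tendsto (kerNum w) leftEnd (𝓝 0) := by
    have h := (tendsto_Phi_leftEnd.cexp.sub ((hc.tendsto 0).comp he)).mul he
    rw [mul_zero] at h
    exact h
  have hD : Tendsto (kerDen w) leftEnd (𝓝 (-w)) := by
    have h := ((he.pow 2).const_add 1).mul (he.sub_const w)
    simp only [ne_eq, OfNat.ofNat_ne_zero, not_false_eq_true, zero_pow, add_zero, zero_sub,
      one_mul] at h
    exact h
  have hw' : -w ≠ 0 := neg_ne_zero.2 hw0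
  have h := hN.div hD hw'
  rw [zero_div] at h
  refine h.congr' ?_
  filter_upwards [hD.eventually_ne hw'] with ζ hζ
  exact (ker_of_ne hζ).symm

lemma tendsto_exp_neg_rightEnd : Tendsto (fun ζ => Complex.exp (-ζ)) rightEnd (𝓝 0) :=
  tendsto_exp_leftEnd.comp tendsto_neg_rightEnd

lemma tendsto_exp_Phi_mul_rightEnd :
    Tendsto (fun ζ => Complex.exp (Phi ζ) * Complex.exp (-ζ) ^ 2) rightEnd (𝓝 0) := by
  have h1 : Tendsto (fun ζ => Complex.exp (-ζ / 2)) rightEnd (𝓝 0) := by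
    rw [tendsto_zero_iff_norm_tendsto_zero]
    simp only [Complex.norm_exp]
    have h : Tendsto (fun x : ℝ => Real.exp (-x / 2)) atTop (𝓝 0) :=
      Real.tendsto_exp_atBot.comp (tendsto_neg_atTop_atBot.atBot_div_const two_pos)
    refine (h.comp tendsto_re_rightEnd).congr fun ζ => ?_
    simp
  have h2 := (tendsto_Phi_leftEnd.comp tendsto_neg_rightEnd).cexp
  have h3 := (h2.mul tendsto_exp_neg_rightEnd).mul h1
  rw [mul_zero] at h3
  refine h3.congr' ?_
  filter_upwards [eventually_im_rightEnd] with ζ hζ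
  have h4 := Phi_sub_Phi_neg (mem_strip_of_abs_im_le hζ)
  simp only [Function.comp]
  rw [← Complex.exp_add, ← Complex.exp_add, ← Complex.exp_nat_mul, ← Complex.exp_add]
  congr 1
  push_cast
  linear_combination -h4

lemma tendsto_ker_rightEnd (w : ℂ) : Tendsto (ker w) rightEnd (𝓝 (-interpCoeff w)) := by
  have hq := tendsto_exp_neg_rightEnd
  have hN : Tendsto (fun ζ => kerNum w ζ * Complex.exp (-ζ) ^ 3) rightEnd
      (𝓝 (-interpCoeff w)) := by
    have hc : Continuous fun q : ℂ => interpCoeff w * (q ^ 2 + 1) +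
        Real.sqrt 2 * (Real.cos (Real.pi / 8) * q ^ 2 + Real.sin (Real.pi / 8) * q) := by fun_prop
    have h := tendsto_exp_Phi_mul_rightEnd.sub ((hc.tendsto 0).comp hq)
    have e : (0 : ℂ) - (interpCoeff w * (0 ^ 2 + 1) +
        Real.sqrt 2 * (Real.cos (Real.pi / 8) * 0 ^ 2 + Real.sin (Real.pi / 8) * 0)) =
        -interpCoeff w := by ring
    rw [e] at h
    refine h.congr fun ζ => ?_
    have he := Complex.exp_ne_zero ζ
    simp only [Function.comp, kerNum, interpPoly, Complex.exp_neg]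
    field_simp
  have hD : Tendsto (fun ζ => kerDen w ζ * Complex.exp (-ζ) ^ 3) rightEnd (𝓝 1) := by
    have hc : Continuous fun q : ℂ => (q ^ 2 + 1) * (1 - w * q) := by fun_prop
    have h := (hc.tendsto 0).comp hq
    have e : ((0 : ℂ) ^ 2 + 1) * (1 - w * 0) = 1 := by ring
    rw [e] at h
    refine h.congr fun ζ => ?_
    have he := Complex.exp_ne_zero ζ
    simp only [Function.comp, kerDen, phiDen, Complex.exp_neg]
    field_simp
  have h := hN.div hD one_ne_zero
  rw [div_one] at h
  refine h.congr' ?_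
  filter_upwards [hD.eventually_ne one_ne_zero] with ζ hζ
  rw [ker_of_ne (left_ne_zero_of_mul hζ)]
  exact mul_div_mul_right _ _ (right_ne_zero_of_mul hζ)

lemma intervalIntegrable_vertical {g : ℂ → ℂ} (hg : ContinuousOn g strip) (x : ℝ) :
    IntervalIntegrable (fun y : ℝ => g (x + y * I)) volume (-Real.pi) Real.pi := by
  have hpi : -Real.pi ≤ Real.pi := by linarith [Real.pi_pos]
  refine ContinuousOn.intervalIntegrable_of_Icc hpi (hg.comp (by fun_prop) fun y hy => ?_)
  exact mem_strip_of_abs_im_le (by simpa [abs_le] using hy)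

lemma tendsto_integral_vertical {g : ℂ → ℂ} (hg : ContinuousOn g strip) {L : ℂ} {s : ℝ → ℝ}
    (h : ∀ ε > 0, ∀ᶠ R in atTop, ∀ y : ℝ, |y| ≤ Real.pi → ‖g (s R + y * I) - L‖ ≤ ε) :
    Tendsto (fun R => ∫ y : ℝ in -Real.pi..Real.pi, g (s R + y * I)) atTop
      (𝓝 (2 * Real.pi * L)) := by
  have hpi := Real.pi_pos
  rw [Metric.tendsto_nhds]
  intro ε hε
  filter_upwards [h (ε / (4 * Real.pi)) (by positivity)] with R hR
  have e : (∫ y : ℝ in -Real.pi..Real.pi, g (s R + y * I)) - 2 * Real.pi * L =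
      ∫ y : ℝ in -Real.pi..Real.pi, (g (s R + y * I) - L) := by
    rw [intervalIntegral.integral_sub (intervalIntegrable_vertical hg _) (by simp),
      intervalIntegral.integral_const, Complex.real_smul]
    push_cast
    ring
  rw [dist_eq_norm, e]
  have hb := intervalIntegral.norm_integral_le_of_norm_le_const (a := -Real.pi) (b := Real.pi)
    (C := ε / (4 * Real.pi)) (f := fun y : ℝ => g (s R + y * I) - L) (fun y hy => by
      rw [uIoc_of_le (by linarith)] at hy
      exact hR y (abs_le.2 ⟨hy.1.le, hy.2⟩))
  refine hb.trans_lt ?_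
  rw [abs_of_pos (by linarith)]
  have : ε / (4 * Real.pi) * (Real.pi - -Real.pi) = ε / 2 := by field_simp; ring
  linarith

/-- The density of the Stieltjes integral giving the Laplace transform of `rfun`. -/
noncomputable def stieltjesDensity (t : ℝ) : ℝ := t / (1 + t ^ 2) * Real.exp (-etaF t)

lemma continuous_stieltjesDensity : Continuous stieltjesDensity := by
  have := continuous_etaF
  refine Continuous.mul (continuous_id.div (by fun_prop) fun t => by positivity) (by fun_prop)

lemma le_norm_ofReal_add {w : ℂ} (hw : 0 < w.re) (t : ℝ) : t ≤ ‖(t : ℂ) + w‖ := by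
  have := Complex.re_le_norm ((t : ℂ) + w)
  simp at this
  linarith

lemma integrableOn_stieltjesDensity_div {w : ℂ} (hw : 0 < w.re) :
    IntegrableOn (fun t : ℝ => (stieltjesDensity t : ℂ) / (t + w)) (Ioi 0) := by
  obtain ⟨C, hC0, hC⟩ := exists_exp_neg_etaF_le
  have hm : Measurable (fun t : ℝ => (stieltjesDensity t : ℂ) / (t + w)) := by
    have := continuous_stieltjesDensity.measurable
    fun_prop
  refine (integrable_one_div_one_add_sq.const_mul C).integrableOn.mono' hm.aestronglyMeasurable
    ((ae_restrict_mem measurableSet_Ioi).mono fun t ht => ?_)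
  have ht0 : (0 : ℝ) < t := ht
  have hle := le_norm_ofReal_add hw t
  have hD : 0 ≤ stieltjesDensity t := by unfold stieltjesDensity; positivity
  rw [norm_div, Complex.norm_of_nonneg hD, div_le_iff₀ (by linarith), stieltjesDensity]
  have := hC t ht0.le
  calc t / (1 + t ^ 2) * Real.exp (-etaF t) ≤ t / (1 + t ^ 2) * C := by gcongr
    _ = C * (1 / (1 + t ^ 2)) * t := by ring
    _ ≤ _ := by gcongr

lemma ker_boundary_sub {w : ℂ} (hw : 0 < w.re) (x : ℝ) :
    ker w (x + (-1 * Real.pi : ℝ) * I) - ker w (x + (1 * Real.pi : ℝ) * I) =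
      -2 * I * (|Real.exp x| • ((stieltjesDensity (Real.exp x) : ℂ) / ((Real.exp x : ℝ) + w))) := by
  have hpos : (1 + (Real.exp x : ℂ) ^ 2) ≠ 0 := by
    have : 0 < 1 + Real.exp x ^ 2 := by positivity
    exact_mod_cast this.ne'
  have hne : (Real.exp x : ℂ) + w ≠ 0 := by
    intro h
    have h1 := le_norm_ofReal_add hw (Real.exp x)
    rw [h, norm_zero] at h1
    linarith [Real.exp_pos x]
  have hk : ∀ σ : ℝ, σ = 1 ∨ σ = -1 → ker w (x + (σ * Real.pi : ℝ) * I) =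
      (Real.exp (-etaF (Real.exp x)) * (1 + σ * Real.exp x * I) - interpPoly w (-(Real.exp x : ℝ))) *
        Real.exp x / ((1 + (Real.exp x : ℂ) ^ 2) * (Real.exp x + w)) := by
    intro σ hσ
    have e1 : Complex.exp (x + (σ * Real.pi : ℝ) * I) = -(Real.exp x : ℝ) := by
      rw [Complex.exp_add, exp_pi_sign hσ, Complex.ofReal_exp]; ring
    have e2 : kerDen w (x + (σ * Real.pi : ℝ) * I) =
        -((1 + (Real.exp x : ℂ) ^ 2) * (Real.exp x + w)) := by
      rw [kerDen, phiDen, e1]; ring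
    rw [ker_of_ne (by rw [e2]; exact neg_ne_zero.2 (mul_ne_zero hpos hne)), e2, kerNum,
      exp_Phi_boundary hσ, e1, mul_neg, neg_div_neg_eq]
  rw [hk _ (Or.inr rfl), hk _ (Or.inl rfl), abs_of_pos (Real.exp_pos x), Complex.real_smul,
    stieltjesDensity]
  rw [← sub_div]
  push_cast
  push_cast at hpos hne
  field_simp
  ring

lemma integral_stieltjesDensity_div {w : ℂ} (hw : 0 < w.re) :
    ∫ t in Ioi (0 : ℝ), (stieltjesDensity t : ℂ) / (t + w) = -Real.pi * interpCoeff w := by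
  have hpi := Real.pi_pos
  set f : ℝ → ℂ := fun t => (stieltjesDensity t : ℂ) / (t + w) with hf
  have himg : Real.exp '' univ = Ioi 0 := by rw [image_univ, Real.range_exp]
  have hder : ∀ x ∈ univ, HasDerivWithinAt Real.exp (Real.exp x) univ x := fun x _ =>
    (Real.hasDerivAt_exp x).hasDerivWithinAt
  have hint : Integrable fun x : ℝ => |Real.exp x| • f (Real.exp x) := by
    have := (integrableOn_image_iff_integrableOn_abs_deriv_smul MeasurableSet.univ hder
      Real.exp_injective.injOn f).1 (by rw [himg]; exact integrableOn_stieltjesDensity_div hw)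
    rwa [integrableOn_univ] at this
  have hval : ∫ t in Ioi (0 : ℝ), f t = ∫ x : ℝ, |Real.exp x| • f (Real.exp x) := by
    rw [← himg, integral_image_eq_integral_abs_deriv_smul MeasurableSet.univ hder
      Real.exp_injective.injOn f, setIntegral_univ]
  have hc := (differentiableOn_ker hw).continuousOn
  have hH : Tendsto (fun R : ℝ => ∫ x in -R..R, (-2 * I) * (|Real.exp x| • f (Real.exp x))) atTop
      (𝓝 ((-2 * I) * ∫ t in Ioi (0 : ℝ), f t)) := by
    rw [hval, ← integral_const_mul]
    exact intervalIntegral_tendsto_integral (hint.const_mul _) tendsto_neg_atTop_atBot tendsto_id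
  have hR : Tendsto (fun R : ℝ => ∫ y : ℝ in -Real.pi..Real.pi, ker w ((R : ℝ) + y * I)) atTop
      (𝓝 (2 * Real.pi * -interpCoeff w)) := by
    refine tendsto_integral_vertical (s := fun R => R) hc fun ε hε => ?_
    obtain ⟨a, ha⟩ := eventually_rightEnd.1 (Metric.tendsto_nhds.1 (tendsto_ker_rightEnd w) ε hε)
    filter_upwards [eventually_ge_atTop a] with R hR y hy
    have := ha (R + y * I) (by simpa using hR) (by simpa using hy)
    rw [dist_eq_norm] at this
    exact this.le
  have hL : Tendsto (fun R : ℝ => ∫ y : ℝ in -Real.pi..Real.pi, ker w ((-R : ℝ) + y * I)) atTop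
      (𝓝 (2 * Real.pi * 0)) := by
    refine tendsto_integral_vertical (s := fun R => -R) hc fun ε hε => ?_
    obtain ⟨a, ha⟩ := eventually_leftEnd.1 (Metric.tendsto_nhds.1 (tendsto_ker_leftEnd hw) ε hε)
    filter_upwards [eventually_ge_atTop (-a)] with R hR y hy
    have := ha ((-R : ℝ) + y * I) (by simp; linarith) (by simpa using hy)
    rw [dist_eq_norm] at this
    exact this.le
  have hrect : ∀ R : ℝ, 0 ≤ R →
      (∫ x in -R..R, (-2 * I) * (|Real.exp x| • f (Real.exp x))) +
        I * (∫ y : ℝ in -Real.pi..Real.pi, ker w ((R : ℝ) + y * I)) -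
        I * (∫ y : ℝ in -Real.pi..Real.pi, ker w ((-R : ℝ) + y * I)) = 0 := by
    intro R hR
    have hh : ∀ σ : ℝ, σ = 1 ∨ σ = -1 →
        IntervalIntegrable (fun x : ℝ => ker w (x + (σ * Real.pi : ℝ) * I)) volume (-R) R := by
      intro σ hσ
      refine ContinuousOn.intervalIntegrable_of_Icc (by linarith)
        (hc.comp (by fun_prop) fun x _ => ?_)
      exact mem_strip_of_abs_im_le (by simpa using abs_sign_mul_pi hσ)
    have h := integral_boundary_rect_eq_zero_of_differentiableOn (ker w)
      (⟨-R, -1 * Real.pi⟩ : ℂ) (⟨R, 1 * Real.pi⟩ : ℂ) ((differentiableOn_ker hw).mono (by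
        intro ζ hζ
        have him : ζ.im ∈ uIcc (-1 * Real.pi) (1 * Real.pi) := hζ.2
        rw [uIcc_of_le (by linarith)] at him
        exact mem_strip_of_abs_im_le (abs_le.2 ⟨by linarith [him.1], by linarith [him.2]⟩)))
    simp only [smul_eq_mul] at h
    rw [← intervalIntegral.integral_sub (hh (-1) (Or.inr rfl)) (hh 1 (Or.inl rfl))] at h
    simp only [ker_boundary_sub hw] at h
    simpa only [neg_one_mul, one_mul] using h
  have hlim := (hH.add (hR.const_mul I)).sub (hL.const_mul I)
  have hzero : Tendsto (fun R : ℝ =>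
      (∫ x in -R..R, (-2 * I) * (|Real.exp x| • f (Real.exp x))) +
        I * (∫ y : ℝ in -Real.pi..Real.pi, ker w ((R : ℝ) + y * I)) -
        I * (∫ y : ℝ in -Real.pi..Real.pi, ker w ((-R : ℝ) + y * I))) atTop (𝓝 0) := by
    refine tendsto_const_nhds.congr' ?_
    filter_upwards [eventually_ge_atTop 0] with R hR
    exact (hrect R hR).symm
  have heq := tendsto_nhds_unique hlim hzero
  have hI := Complex.I_ne_zero
  apply mul_left_cancel₀ (mul_ne_zero two_ne_zero hI)
  linear_combination -heq

lemma integral_exp_neg_mul_Ioi_zero {a : ℂ} (ha : 0 < a.re) :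
    ∫ x in Ioi (0 : ℝ), Complex.exp (-a * x) = 1 / a := by
  rw [integral_exp_mul_complex_Ioi (by simpa using ha)]
  simp

lemma integrable_prod_stieltjesDensity_mul_exp {w : ℂ} (hw : 0 < w.re) :
    Integrable (fun p : ℝ × ℝ => (stieltjesDensity p.1 : ℂ) * Complex.exp (-(p.1 + w) * p.2))
      ((volume.restrict (Ioi (0 : ℝ))).prod (volume.restrict (Ioi (0 : ℝ)))) := by
  have hcont := continuous_stieltjesDensity
  have hm : AEStronglyMeasurable
      (fun p : ℝ × ℝ => (stieltjesDensity p.1 : ℂ) * Complex.exp (-(p.1 + w) * p.2))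
      ((volume.restrict (Ioi (0 : ℝ))).prod (volume.restrict (Ioi (0 : ℝ)))) :=
    Continuous.aestronglyMeasurable (by fun_prop)
  rw [integrable_prod_iff hm]
  constructor
  · filter_upwards [ae_restrict_mem measurableSet_Ioi] with t ht
    rw [mem_Ioi] at ht
    exact (integrableOn_exp_mul_complex_Ioi (a := -(t + w))
      (by simp only [Complex.neg_re, Complex.add_re, Complex.ofReal_re]; linarith) 0).const_mul _
  · have hw' : 0 < (w.re : ℂ).re := by simpa using hw
    refine (integrableOn_stieltjesDensity_div hw').norm.congr ?_
    filter_upwards [ae_restrict_mem measurableSet_Ioi] with t ht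
    rw [mem_Ioi] at ht
    have h : ∀ x : ℝ, ‖(stieltjesDensity t : ℂ) * Complex.exp (-(t + w) * x)‖ =
        ‖(stieltjesDensity t : ℂ)‖ * Real.exp (-(t + w.re) * x) := by
      intro x
      rw [norm_mul, Complex.norm_exp]
      simp
    simp only [h]
    rw [integral_const_mul, integral_exp_mul_Ioi (by linarith), norm_div, ← Complex.ofReal_add,
      Complex.norm_of_nonneg (by linarith : 0 ≤ t + w.re)]
    simp [div_eq_mul_inv, -neg_add_rev]

lemma ofReal_rfun_mul_exp (w : ℂ) (x : ℝ) :
    (rfun x : ℂ) * Complex.exp (-w * x) = (Real.sqrt 2 / (2 * Real.pi) : ℂ) *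
      ∫ t in Ioi (0 : ℝ), (stieltjesDensity t : ℂ) * Complex.exp (-(t + w) * x) := by
  rw [rfun, Complex.ofReal_mul, ← integral_complex_ofReal, mul_assoc, ← integral_mul_const]
  push_cast
  congr 1
  refine integral_congr_ae (Eventually.of_forall fun t => ?_)
  simp only [stieltjesDensity]
  push_cast
  rw [show -((t : ℂ) + w) * x = -t * x + -w * x by ring, Complex.exp_add]
  ring

lemma integrableOn_rfun_mul_exp {w : ℂ} (hw : 0 < w.re) :
    IntegrableOn (fun x : ℝ => (rfun x : ℂ) * Complex.exp (-w * x)) (Ioi 0) := by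
  simp only [ofReal_rfun_mul_exp]
  exact (integrable_prod_stieltjesDensity_mul_exp hw).integral_prod_right.const_mul _

lemma integral_rfun_mul_exp {w : ℂ} (hw : 0 < w.re) :
    ∫ x in Ioi (0 : ℝ), (rfun x : ℂ) * Complex.exp (-w * x) =
      -(Real.sqrt 2 / 2) * interpCoeff w := by
  simp only [ofReal_rfun_mul_exp]
  rw [integral_const_mul, ← integral_integral_swap (integrable_prod_stieltjesDensity_mul_exp hw)]
  have h : ∫ t in Ioi (0 : ℝ), ∫ x in Ioi (0 : ℝ),
      (stieltjesDensity t : ℂ) * Complex.exp (-(t + w) * x) =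
      ∫ t in Ioi (0 : ℝ), (stieltjesDensity t : ℂ) / (t + w) := by
    refine setIntegral_congr_fun measurableSet_Ioi fun t ht => ?_
    rw [mem_Ioi] at ht
    rw [integral_const_mul, integral_exp_neg_mul_Ioi_zero (by
      simp only [Complex.add_re, Complex.ofReal_re]; linarith), mul_one_div]
  rw [h, integral_stieltjesDensity_div hw]
  have := pi_ne_zero_complex
  field_simp

lemma ofReal_sin_add_mul_exp (w : ℂ) (a x : ℝ) :
    (Real.sin (x + a) : ℂ) * Complex.exp (-w * x) =
      Complex.exp (-a * I) * I / 2 * Complex.exp (-(w + I) * x) -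
        Complex.exp (a * I) * I / 2 * Complex.exp (-(w - I) * x) := by
  rw [Complex.ofReal_sin, Complex.sin]
  push_cast
  rw [show -(w + I) * (x : ℂ) = -x * I + -w * x by ring,
    show -(w - I) * (x : ℂ) = x * I + -w * x by ring,
    show -((x : ℂ) + a) * I = -x * I + -a * I by ring,
    show ((x : ℂ) + a) * I = x * I + a * I by ring]
  simp only [Complex.exp_add]
  ring

lemma integrableOn_sin_add_mul_exp {w : ℂ} (hw : 0 < w.re) (a : ℝ) :
    IntegrableOn (fun x : ℝ => (Real.sin (x + a) : ℂ) * Complex.exp (-w * x)) (Ioi 0) := by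
  simp only [ofReal_sin_add_mul_exp]
  exact ((integrableOn_exp_mul_complex_Ioi (by simpa using hw) 0).const_mul _).sub
    ((integrableOn_exp_mul_complex_Ioi (by simpa using hw) 0).const_mul _)

lemma integral_sin_add_mul_exp {w : ℂ} (hw : 0 < w.re) (a : ℝ) :
    ∫ x in Ioi (0 : ℝ), (Real.sin (x + a) : ℂ) * Complex.exp (-w * x) =
      (Real.cos a + Real.sin a * w) / (1 + w ^ 2) := by
  have h1 : 0 < (w + I).re := by simpa using hw
  have h2 : 0 < (w - I).re := by simpa using hw
  have n1 : w + I ≠ 0 := fun h => by simp [h] at h1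
  have n2 : w - I ≠ 0 := fun h => by simp [h] at h2
  have n3 := one_add_sq_ne_zero hw
  simp only [ofReal_sin_add_mul_exp]
  rw [integral_sub
    ((integrableOn_exp_mul_complex_Ioi (by simpa using hw) 0).const_mul _)
    ((integrableOn_exp_mul_complex_Ioi (by simpa using hw) 0).const_mul _),
    integral_const_mul, integral_const_mul, integral_exp_neg_mul_Ioi_zero h1,
    integral_exp_neg_mul_Ioi_zero h2]
  have e1 : Complex.exp (a * I) = Real.cos a + Real.sin a * I := by
    rw [Complex.exp_mul_I, Complex.ofReal_cos, Complex.ofReal_sin]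
  have e2 : Complex.exp (-a * I) = Real.cos a - Real.sin a * I := by
    rw [Complex.exp_mul_I, Complex.cos_neg, Complex.sin_neg, Complex.ofReal_cos,
      Complex.ofReal_sin]
    ring
  have n4 : (w + I) * (w - I) = 1 + w ^ 2 := by linear_combination -Complex.I_sq
  rw [e1, e2, ← n4]
  field_simp
  linear_combination (-2 * (Real.cos a : ℂ) - 2 * Real.sin a * w) * Complex.I_sq

lemma integral_sin_sub_rfun_mul_exp {w : ℂ} (hw : 0 < w.re) :
    ∫ x in Ioi (0 : ℝ), ((Real.sin (x + Real.pi / 8) - rfun x : ℝ) : ℂ) * Complex.exp (-w * x) =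
      Real.sqrt 2 / 2 * Complex.exp (Bfun w) / (1 + w ^ 2) := by
  have hs : (Real.sqrt 2 : ℂ) ^ 2 = 2 := by
    rw [← Complex.ofReal_pow, Real.sq_sqrt zero_le_two]
    norm_num
  have hn := one_add_sq_ne_zero hw
  simp only [Complex.ofReal_sub, sub_mul]
  rw [integral_sub (integrableOn_sin_add_mul_exp hw _) (integrableOn_rfun_mul_exp hw),
    integral_sin_add_mul_exp hw, integral_rfun_mul_exp hw, interpCoeff]
  field_simp
  linear_combination (-(Real.cos (Real.pi / 8) : ℂ) - Real.sin (Real.pi / 8) * w) * hs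

end

theorem laplace_transform_psi (lam : ℝ) (hlam : 0 < lam) (z : ℂ) (hz : 0 < z.re) :
    (∫ x in Ioi (0 : ℝ), (psi lam x : ℂ) * Complex.exp (-z * x))
      = (Real.sqrt 2 / 2 : ℂ) * (lam : ℂ) * Complex.exp (Bfun (z / lam)) / ((lam : ℂ) ^ 2 + z ^ 2) := by
  have hl : (lam : ℂ) ≠ 0 := Complex.ofReal_ne_zero.2 hlam.ne'
  have hw : 0 < (z / lam).re := by
    rw [Complex.div_ofReal_re]
    positivity
  have h := integral_comp_mul_left_Ioi (fun y : ℝ =>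
    ((Real.sin (y + Real.pi / 8) - rfun y : ℝ) : ℂ) * Complex.exp (-(z / lam) * y)) 0 hlam
  rw [mul_zero, integral_sin_sub_rfun_mul_exp hw] at h
  have e : (∫ x in Ioi (0 : ℝ), (psi lam x : ℂ) * Complex.exp (-z * x)) =
      ∫ x in Ioi (0 : ℝ), ((Real.sin (lam * x + Real.pi / 8) - rfun (lam * x) : ℝ) : ℂ) *
        Complex.exp (-(z / lam) * (lam * x : ℝ)) := by
    refine setIntegral_congr_fun measurableSet_Ioi fun x hx => ?_
    have hx' : -(z / lam) * ((lam * x : ℝ) : ℂ) = -z * x := by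
      push_cast
      field_simp
    simp only [psi, if_pos (mem_Ioi.1 hx), hx']
  have hn := one_add_sq_ne_zero hw
  have hd : (lam : ℂ) ^ 2 * (1 + (z / lam) ^ 2) = lam ^ 2 + z ^ 2 := by
    field_simp
  rw [e, h, ← hd, Complex.real_smul]
  push_cast
  generalize 1 + (z / (lam : ℂ)) ^ 2 = d at hn ⊢
  field_simp
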